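/- arXiv:math/0403062 — 16 statements merged into one kernel-verified Lean document; each statement's English description precedes it below -/
import Mathlib

section
/- Let R be a finite ring in which every right identity element is a two-sided identity. Then every left zero-divisor of R is also a right zero-divisor, i.e., if a ∈ R satisfies ab = 0 for some b ≠ 0, then there exists x ≠ 0 with xa = 0. -/
variable {R : Type*} [NonUnitalRing R]

/-- `x` is a left zero-divisor. -/
def IsLeftZD (x : R) : Prop := ∃ y : R, y ≠ 0 ∧ x * y = 0

/-- `x` is a right zero-divisor. -/
def IsRightZD (x : R) : Prop := ∃ y : R, y ≠ 0 ∧ y * x = 0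

/-- `x` is a vertex of the directed zero-divisor graph `Γ(R)`,
i.e. a nonzero (one-sided) zero-divisor. -/
def IsVertex (x : R) : Prop := x ≠ 0 ∧ (IsLeftZD x ∨ IsRightZD x)

/-- Directed edge `x → y` of `Γ(R)`: distinct vertices with `x * y = 0`. -/
def Edge (x y : R) : Prop := IsVertex x ∧ IsVertex y ∧ x ≠ y ∧ x * y = 0

/-- A sink of `Γ(R)`: a vertex with positive in-degree and zero out-degree. -/
def IsSink (x : R) : Prop :=
  IsVertex x ∧ (∃ y : R, IsVertex y ∧ y ≠ x ∧ y * x = 0) ∧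
    ¬ ∃ y : R, IsVertex y ∧ y ≠ x ∧ x * y = 0

/-- A source of `Γ(R)`: a vertex with positive out-degree and zero in-degree. -/
def IsSource (x : R) : Prop :=
  IsVertex x ∧ (∃ y : R, IsVertex y ∧ y ≠ x ∧ x * y = 0) ∧
    ¬ ∃ y : R, IsVertex y ∧ y ≠ x ∧ y * x = 0

/-- `e` is a left identity of `R`. -/
def IsLeftId (e : R) : Prop := ∀ x : R, e * x = x

/-- `e` is a right identity of `R`. -/
def IsRightId (e : R) : Prop := ∀ x : R, x * e = x

/-- There is a directed path of length `n` from `x` to `y` in `Γ(R)`. -/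
def HasPathLen (n : ℕ) (x y : R) : Prop :=
  ∃ f : ℕ → R, f 0 = x ∧ f n = y ∧ ∀ i < n, Edge (f i) (f (i + 1))

/-- Every left zero-divisor of a finite ring in which every right identity is
two-sided is also a right zero-divisor. -/
theorem stmt0 {R : Type*} [NonUnitalRing R] [Fintype R]
    (hid : ∀ e : R, IsRightId e → IsLeftId e)
    (a : R) (ha : ∃ b : R, b ≠ 0 ∧ a * b = 0) :
    ∃ x : R, x ≠ 0 ∧ x * a = 0 := by
  by_contra! h
  obtain ⟨b, hb, hab⟩ := ha
  have hinj : Function.Injective (fun x : R => x * a) := by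
    intro x y hxy
    by_contra hne
    exact h (x - y) (sub_ne_zero.mpr hne) (by rw [sub_mul, sub_eq_zero]; exact hxy)
  have hsurj := Finite.surjective_of_injective hinj
  obtain ⟨e, he : e * a = a⟩ := hsurj a
  obtain ⟨c, hc : c * a = e⟩ := hsurj e
  have hright : IsRightId e := fun x => hinj (by simp only [mul_assoc, he])
  apply hb
  rw [← hid e hright b, ← hc, mul_assoc, hab, mul_zero]
end

section
/- Let R be a finite ring with at least five elements in which every right identity element is a two-sided identity. If a, b ∈ R are distinct nonzero elements with ab = 0, then there exists a nonzero c ∈ R with c ≠ a and ca = 0. -/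
variable {R : Type*} [NonUnitalRing R]

/-- If right multiplication by `a` is injective on a finite ring, some right identity `e` is a left
multiple of `a`. -/
theorem exists_isRightId_of_mul_right_injective {R : Type*} [NonUnitalRing R] [Finite R] {a : R}
    (hinj : Function.Injective fun x : R => x * a) :
    ∃ e d : R, IsRightId e ∧ d * a = e := by
  have hsurj := Finite.surjective_of_injective hinj
  obtain ⟨e, he⟩ := hsurj a
  obtain ⟨d, hd⟩ := hsurj e
  refine ⟨e, d, fun x => hinj ?_, hd⟩
  have he' : e * a = a := he
  simp only [mul_assoc, he']

/-- If `0` and `a` are the only possible left annihilators of `a` and `a * a = 0`, the ring has at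
most four elements. -/
theorem card_le_four_of_mul_self_eq_zero {R : Type*} [NonUnitalRing R] [Fintype R] {a : R}
    (haa : a * a = 0) (hL : ∀ c : R, c * a = 0 → c = 0 ∨ c = a) :
    Fintype.card R ≤ 4 := by
  classical
  have hfib : ∀ y ∈ Finset.univ.image (fun x : R => x * a),
      (Finset.univ.filter fun x : R => x * a = y).card ≤ 2 := by
    intro y hy
    obtain ⟨x₀, -, rfl⟩ := Finset.mem_image.1 hy
    refine (Finset.card_le_card (t := {x₀, x₀ + a}) fun x hx => ?_).trans Finset.card_le_two
    have hx' : x * a = x₀ * a := (Finset.mem_filter.1 hx).2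
    rcases hL (x - x₀) (by rw [sub_mul, hx', sub_self]) with h | h
    · simp [sub_eq_zero.1 h]
    · simp [← h]
  have himage : (Finset.univ.image (fun x : R => x * a)).card ≤ 2 := by
    refine (Finset.card_le_card (t := {0, a}) fun y hy => ?_).trans Finset.card_le_two
    obtain ⟨x, -, rfl⟩ := Finset.mem_image.1 hy
    simpa using hL (x * a) (by rw [mul_assoc, haa, mul_zero])
  have hcard := Finset.card_le_mul_card_image (Finset.univ : Finset R) 2 hfib
  rw [Finset.card_univ] at hcard
  omega

theorem stmt1 {R : Type*} [NonUnitalRing R] [Fintype R]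
    (hcard : 5 ≤ Fintype.card R)
    (hid : ∀ e : R, IsRightId e → IsLeftId e)
    (a b : R) (hab : a ≠ b) (ha : a ≠ 0) (hb : b ≠ 0) (h : a * b = 0) :
    ∃ c : R, c ≠ 0 ∧ c ≠ a ∧ c * a = 0 := by
  by_contra! hno
  have hL : ∀ c : R, c * a = 0 → c = 0 ∨ c = a := fun c hc => by
    by_contra! hc'
    exact hno c hc'.1 hc'.2 hc
  by_cases haa : a * a = 0
  · have := card_le_four_of_mul_self_eq_zero haa hL
    omega
  · have hinj : Function.Injective fun x : R => x * a := fun x y hxy => by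
      have hxy' : x * a = y * a := hxy
      rcases hL (x - y) (by rw [sub_mul, hxy', sub_self]) with h0 | h0
      · exact sub_eq_zero.1 h0
      · refine absurd ?_ haa
        calc a * a = (x - y) * a := by rw [h0]
          _ = 0 := by rw [sub_mul, hxy', sub_self]
    obtain ⟨e, d, he, hd⟩ := exists_isRightId_of_mul_right_injective hinj
    apply hb
    rw [← hid e he b, ← hd, mul_assoc, h, mul_zero]
end

section
/- Let R be a ring with at most four elements in which every one-sided identity element (left or right) is a two-sided identity. Then for all distinct nonzero a, b ∈ R, if ab = 0 then ba = 0. -/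
variable {R : Type*} [NonUnitalRing R]

/-- In a ring with at most four elements, two distinct nonzero elements with nonzero sum
exhaust the ring together with `0` and their sum. -/
theorem eq_zero_or_eq_or_eq_or_eq_add {R : Type*} [NonUnitalRing R] [Fintype R]
    (hcard : Fintype.card R ≤ 4) {a b : R} (hab : a ≠ b) (ha : a ≠ 0) (hb : b ≠ 0)
    (hs : a + b ≠ 0) (x : R) : x = 0 ∨ x = a ∨ x = b ∨ x = a + b := by
  classical
  by_contra! hx
  obtain ⟨h0, h1, h2, h3⟩ := hx
  have h5 : ({x, 0, a, b, a + b} : Finset R).card = 5 := by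
    simp [Finset.card_insert_of_notMem, h0, h1, h2, h3, hab, ha, hb, hs.symm, ha.symm, hb.symm]
  have := Finset.card_le_univ ({x, 0, a, b, a + b} : Finset R)
  omega

theorem stmt2 {R : Type*} [NonUnitalRing R] [Fintype R]
    (hcard : Fintype.card R ≤ 4)
    (hl : ∀ e : R, IsLeftId e → IsRightId e)
    (hr : ∀ e : R, IsRightId e → IsLeftId e)
    (a b : R) (hab : a ≠ b) (ha : a ≠ 0) (hb : b ≠ 0) (h : a * b = 0) :
    b * a = 0 := by
  by_contra hc
  have hs : a + b ≠ 0 := by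
    intro hs
    obtain rfl : b = -a := (neg_eq_of_add_eq_zero_right hs).symm
    exact hc (by simpa using h)
  have key := eq_zero_or_eq_or_eq_or_eq_add hcard hab ha hb hs
  rcases key (b * a) with h1 | h1 | h1 | h1
  · exact hc h1
  · have haa : a * a = 0 := by
      calc a * a = a * (b * a) := by rw [h1]
        _ = 0 := by rw [← mul_assoc, h, zero_mul]
    have hbba : b * b * a = a := by rw [mul_assoc, h1, h1]
    rcases key (b * b) with h2 | h2 | h2 | h2
    · exact ha (by rw [← hbba, h2, zero_mul])
    · exact ha (by rw [← hbba, h2, haa])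
    · have hid : IsLeftId b := by
        intro x
        rcases key x with rfl | rfl | rfl | rfl <;> simp [mul_add, h1, h2]
      exact ha (by rw [← hl b hid a, h])
    · have h3 : b * b * b = b * (b * b) := mul_assoc b b b
      rw [h2, add_mul, mul_add, h, h1, zero_add] at h3
      exact ha (by simpa using h3)
  · have hbb : b * b = 0 := by
      calc b * b = b * a * b := by rw [h1]
        _ = 0 := by rw [mul_assoc, h, mul_zero]
    have hbaa : b * (a * a) = b := by rw [← mul_assoc, h1, h1]
    rcases key (a * a) with h2 | h2 | h2 | h2
    · exact hb (by rw [← hbaa, h2, mul_zero])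
    · have hid : IsRightId a := by
        intro x
        rcases key x with rfl | rfl | rfl | rfl <;> simp [add_mul, h1, h2]
      exact hb (by rw [← hr a hid b, h])
    · exact hb (by rw [← hbaa, h2, hbb])
    · have h3 : a * a * a = a * (a * a) := mul_assoc a a a
      rw [h2, add_mul, mul_add, h, h1, add_zero] at h3
      exact hb (by simpa using h3)
  · have haa : a * a = 0 := by
      calc a * a = a * (a + b) := by rw [mul_add, h, add_zero]
        _ = 0 := by rw [← h1, ← mul_assoc, h, zero_mul]
    have hbb : b * b = 0 := by
      calc b * b = (a + b) * b := by rw [add_mul, h, zero_add]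
        _ = 0 := by rw [← h1, mul_assoc, h, mul_zero]
    apply hc
    calc b * a = (a + b) * (a + b) := by simp [add_mul, mul_add, haa, hbb, h]
      _ = b * a * (b * a) := by rw [h1]
      _ = b * (a * b) * a := by simp only [mul_assoc]
      _ = 0 := by rw [h, mul_zero, zero_mul]
end

section
/- For a finite ring R, the following are equivalent: (1) for every pair of distinct vertices x, y ∈ Z(R)* there is a directed path from x to y in the directed zero-divisor graph Γ(R); (2) every one-sided identity element of R is a two-sided identity; (3) Γ(R) contains no sink and no source. -/
variable {R : Type*} [NonUnitalRing R]

theorem isSink_of_isLeftId {e : R} (he : IsLeftId e) (h : ¬ IsRightId e) : IsSink e := by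
  simp only [IsRightId, not_forall] at h
  obtain ⟨x, hx⟩ := h
  have hy : x * e - x ≠ 0 := sub_ne_zero.2 hx
  have hye : (x * e - x) * e = 0 := by rw [sub_mul, mul_assoc, he, sub_self]
  have he0 : e ≠ 0 := by
    rintro rfl
    exact hy (by rw [← he (x * 0 - x), zero_mul])
  refine ⟨⟨he0, Or.inr ⟨_, hy, hye⟩⟩, ⟨_, ⟨hy, Or.inl ⟨e, he0, hye⟩⟩, ?_, hye⟩, ?_⟩
  · intro heq
    rw [heq, he] at hye
    exact he0 hye
  · rintro ⟨z, hz, -, hez⟩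
    exact hz.1 (by rwa [he] at hez)

theorem isSource_of_isRightId {e : R} (he : IsRightId e) (h : ¬ IsLeftId e) : IsSource e := by
  simp only [IsLeftId, not_forall] at h
  obtain ⟨x, hx⟩ := h
  have hy : e * x - x ≠ 0 := sub_ne_zero.2 hx
  have hye : e * (e * x - x) = 0 := by rw [mul_sub, ← mul_assoc, he, sub_self]
  have he0 : e ≠ 0 := by
    rintro rfl
    exact hy (by rw [← he (0 * x - x), mul_zero])
  refine ⟨⟨he0, Or.inl ⟨_, hy, hye⟩⟩, ⟨_, ⟨hy, Or.inr ⟨e, he0, hye⟩⟩, ?_, hye⟩, ?_⟩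
  · intro heq
    rw [heq, he] at hye
    exact he0 hye
  · rintro ⟨z, hz, -, hez⟩
    exact hz.1 (by rwa [he] at hez)

theorem IsRightZD.isLeftZD [Finite R] (h : ∀ e : R, IsLeftId e → IsRightId e) {x : R}
    (hx : IsRightZD x) : IsLeftZD x := by
  by_contra hl
  have hcancel : ∀ z, x * z = 0 → z = 0 := fun z hz => by
    by_contra hz0
    exact hl ⟨z, hz0, hz⟩
  have hsurj : Function.Surjective (x * ·) := Finite.surjective_of_injective fun a b hab =>
    sub_eq_zero.1 (hcancel _ (by rw [mul_sub]; exact sub_eq_zero.2 hab))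
  obtain ⟨e, he⟩ := hsurj x
  have hid : IsLeftId e := fun z => sub_eq_zero.1 <| hcancel _ <| by
    rw [mul_sub, ← mul_assoc]
    exact sub_eq_zero.2 (congrArg (· * z) he)
  obtain ⟨u, hu⟩ := hsurj e
  obtain ⟨y, hy, hyx⟩ := hx
  refine hy ?_
  rw [← h e hid y, ← hu]
  simp only [← mul_assoc, hyx, zero_mul]

theorem IsLeftZD.isRightZD [Finite R] (h : ∀ e : R, IsRightId e → IsLeftId e) {x : R}
    (hx : IsLeftZD x) : IsRightZD x := by
  by_contra hl
  have hcancel : ∀ z, z * x = 0 → z = 0 := fun z hz => by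
    by_contra hz0
    exact hl ⟨z, hz0, hz⟩
  have hsurj : Function.Surjective (· * x) := Finite.surjective_of_injective fun a b hab =>
    sub_eq_zero.1 (hcancel _ (by rw [sub_mul]; exact sub_eq_zero.2 hab))
  obtain ⟨e, he⟩ := hsurj x
  have hid : IsRightId e := fun z => sub_eq_zero.1 <| hcancel _ <| by
    rw [sub_mul, mul_assoc]
    exact sub_eq_zero.2 (congrArg (z * ·) he)
  obtain ⟨u, hu⟩ := hsurj e
  obtain ⟨y, hy, hyx⟩ := hx
  refine hy ?_
  rw [← h e hid y, ← hu]
  simp only [mul_assoc, hyx, mul_zero]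

theorem reflTransGen_edge_of_mul_eq_zero {x y : R} (hx : x ≠ 0) (hy : y ≠ 0) (h : x * y = 0) :
    Relation.ReflTransGen Edge x y := by
  by_cases hxy : x = y
  · rw [hxy]
  · exact .single ⟨⟨hx, Or.inl ⟨y, hy, h⟩⟩, ⟨hy, Or.inr ⟨x, hx, h⟩⟩, hxy, h⟩

theorem reflTransGen_edge {x y : R} (hx0 : x ≠ 0) (hy0 : y ≠ 0) (hx : IsLeftZD x)
    (hy : IsRightZD y) : Relation.ReflTransGen Edge x y := by
  obtain ⟨a, ha, hxa⟩ := hx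
  obtain ⟨b, hb, hby⟩ := hy
  by_cases hab : a * b = 0
  · exact ((reflTransGen_edge_of_mul_eq_zero hx0 ha hxa).trans
      (reflTransGen_edge_of_mul_eq_zero ha hb hab)).trans
      (reflTransGen_edge_of_mul_eq_zero hb hy0 hby)
  · exact (reflTransGen_edge_of_mul_eq_zero hx0 hab (by rw [← mul_assoc, hxa, zero_mul])).trans
      (reflTransGen_edge_of_mul_eq_zero hab hy0 (by rw [mul_assoc, hby, mul_zero]))

theorem not_isSink_of_transGen
    (h : ∀ x y : R, IsVertex x → IsVertex y → x ≠ y → Relation.TransGen Edge x y) (x : R) :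
    ¬ IsSink x := by
  rintro ⟨hx, ⟨y, hy, hyx, -⟩, hout⟩
  obtain ⟨z, hz, -⟩ := Relation.TransGen.head'_iff.1 (h x y hx hy hyx.symm)
  exact hout ⟨z, hz.2.1, hz.2.2.1.symm, hz.2.2.2⟩

theorem not_isSource_of_transGen
    (h : ∀ x y : R, IsVertex x → IsVertex y → x ≠ y → Relation.TransGen Edge x y) (x : R) :
    ¬ IsSource x := by
  rintro ⟨hx, ⟨y, hy, hyx, -⟩, hin⟩
  obtain ⟨z, -, hz⟩ := Relation.TransGen.tail'_iff.1 (h y x hy hx hyx)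
  exact hin ⟨z, hz.1, hz.2.2.1, hz.2.2.2⟩

theorem transGen_edge_of_isLeftId_iff_isRightId [Finite R]
    (h : ∀ e : R, (IsLeftId e → IsRightId e) ∧ (IsRightId e → IsLeftId e)) (x y : R)
    (hx : IsVertex x) (hy : IsVertex y) (hxy : x ≠ y) : Relation.TransGen Edge x y := by
  have hx' : IsLeftZD x := hx.2.elim id (IsRightZD.isLeftZD fun e => (h e).1)
  have hy' : IsRightZD y := hy.2.elim (IsLeftZD.isRightZD fun e => (h e).2) id
  exact (Relation.reflTransGen_iff_eq_or_transGen.1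
    (reflTransGen_edge hx.1 hy.1 hx' hy')).resolve_left hxy.symm

theorem isLeftId_iff_isRightId_of_not_isSink_of_not_isSource (hsink : ∀ x : R, ¬ IsSink x)
    (hsource : ∀ x : R, ¬ IsSource x) (e : R) :
    (IsLeftId e → IsRightId e) ∧ (IsRightId e → IsLeftId e) :=
  ⟨fun he => by_contra fun hne => hsink e (isSink_of_isLeftId he hne),
    fun he => by_contra fun hne => hsource e (isSource_of_isRightId he hne)⟩

theorem stmt3 {R : Type*} [NonUnitalRing R] [Fintype R] :
    ((∀ x y : R, IsVertex x → IsVertex y → x ≠ y → Relation.TransGen Edge x y) ↔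
      (∀ e : R, (IsLeftId e → IsRightId e) ∧ (IsRightId e → IsLeftId e))) ∧
    ((∀ e : R, (IsLeftId e → IsRightId e) ∧ (IsRightId e → IsLeftId e)) ↔
      ((¬ ∃ x : R, IsSink x) ∧ ¬ ∃ x : R, IsSource x)) := by
  refine ⟨⟨fun h => ?_, transGen_edge_of_isLeftId_iff_isRightId⟩, fun h => ?_, fun h => ?_⟩
  · exact isLeftId_iff_isRightId_of_not_isSink_of_not_isSource (not_isSink_of_transGen h)
      (not_isSource_of_transGen h)
  · have hconn := transGen_edge_of_isLeftId_iff_isRightId h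
    exact ⟨not_exists.2 (not_isSink_of_transGen hconn),
      not_exists.2 (not_isSource_of_transGen hconn)⟩
  · exact isLeftId_iff_isRightId_of_not_isSink_of_not_isSource (not_exists.1 h.1)
      (not_exists.1 h.2)
end

section
/- Let R be a finite ring possessing a proper one-sided identity element. Then for any distinct vertices x, y ∈ Z(R)*, if there exists a directed path from x to y in Γ(R), then there exists such a path of length at most 6. -/
variable {R : Type*} [NonUnitalRing R]

theorem HasPathLen.cons {R : Type*} [NonUnitalRing R] {x a y : R} {n : ℕ}
    (h : Edge x a) (hp : HasPathLen n a y) : HasPathLen (n + 1) x y := by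
  obtain ⟨f, h0, hn, hf⟩ := hp
  refine ⟨fun i => Nat.casesOn i x f, rfl, hn, fun i hi => ?_⟩
  cases i with
  | zero => simpa [h0] using h
  | succ k => exact hf k (by omega)

/-- If every nonzero element is a vertex, a chain of three vanishing products of nonzero
elements yields a path of length at most three, after removing repetitions. -/
theorem exists_hasPathLen_of_mul_eq_zero {R : Type*} [NonUnitalRing R]
    (hv : ∀ v : R, v ≠ 0 → IsVertex v) {x a b y : R} (hx : x ≠ 0) (ha : a ≠ 0) (hb : b ≠ 0)
    (hy : y ≠ 0) (hxy : x ≠ y) (hxa : x * a = 0) (hab : a * b = 0) (hby : b * y = 0) :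
    ∃ n : ℕ, 1 ≤ n ∧ n ≤ 6 ∧ HasPathLen n x y := by
  have step : ∀ {u v : R} {k : ℕ}, u ≠ 0 → v ≠ 0 → u * v = 0 →
      (∃ n ≤ k, HasPathLen n v y) → ∃ n ≤ k + 1, HasPathLen n u y := by
    rintro u v k hu hv' huv ⟨n, hn, hp⟩
    by_cases h : u = v
    · exact ⟨n, by omega, h ▸ hp⟩
    · exact ⟨n + 1, by omega, hp.cons ⟨hv u hu, hv v hv', h, huv⟩⟩
  obtain ⟨n, hn, hp⟩ := step hx ha hxa (step ha hb hab (step hb hy hby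
    ⟨0, le_rfl, fun _ => y, rfl, rfl, fun i hi => absurd hi (Nat.not_lt_zero i)⟩))
  refine ⟨n, ?_, by omega, hp⟩
  rcases Nat.eq_zero_or_pos n with rfl | h
  · obtain ⟨f, h0, h1, -⟩ := hp
    exact absurd (h0.symm.trans h1) hxy
  · exact h

/-- If some nonzero `n` annihilates `R` from the left, then `x` reaches `y` in at most three
steps as soon as `x` is a left zero-divisor. -/
theorem IsLeftZD.exists_hasPathLen {R : Type*} [NonUnitalRing R] {n x y : R} (hn : n ≠ 0)
    (hann : ∀ u : R, n * u = 0) (hx : x ≠ 0) (hy : y ≠ 0) (hxy : x ≠ y) (h : IsLeftZD x) :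
    ∃ k : ℕ, 1 ≤ k ∧ k ≤ 6 ∧ HasPathLen k x y := by
  have hv : ∀ v : R, v ≠ 0 → IsVertex v := fun v h0 => ⟨h0, Or.inr ⟨n, hn, hann v⟩⟩
  obtain ⟨z, hz, hxz⟩ := h
  by_cases hzn : z * n = 0
  · exact exists_hasPathLen_of_mul_eq_zero hv hx hz hn hy hxy hxz hzn (hann y)
  · have hw : ∀ u, z * n * u = 0 := fun u => by rw [mul_assoc, hann, mul_zero]
    exact exists_hasPathLen_of_mul_eq_zero hv hx hzn hzn hy hxy
      (by rw [← mul_assoc, hxz, zero_mul]) (hw _) (hw y)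

/-- If some nonzero `n` annihilates `R` from the right, then `y` is reached from `x` in at most
three steps as soon as `y` is a right zero-divisor. -/
theorem IsRightZD.exists_hasPathLen {R : Type*} [NonUnitalRing R] {n x y : R} (hn : n ≠ 0)
    (hann : ∀ u : R, u * n = 0) (hx : x ≠ 0) (hy : y ≠ 0) (hxy : x ≠ y) (h : IsRightZD y) :
    ∃ k : ℕ, 1 ≤ k ∧ k ≤ 6 ∧ HasPathLen k x y := by
  have hv : ∀ v : R, v ≠ 0 → IsVertex v := fun v h0 => ⟨h0, Or.inl ⟨n, hn, hann v⟩⟩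
  obtain ⟨z, hz, hzy⟩ := h
  by_cases hnz : n * z = 0
  · exact exists_hasPathLen_of_mul_eq_zero hv hx hn hz hy hxy (hann x) hnz hzy
  · have hw : ∀ u, u * (n * z) = 0 := fun u => by rw [← mul_assoc, hann, zero_mul]
    exact exists_hasPathLen_of_mul_eq_zero hv hx hnz hnz hy hxy (hw x) (hw _)
      (by rw [mul_assoc, hzy, mul_zero])

theorem stmt5 {R : Type*} [NonUnitalRing R] [Fintype R]
    (hid : ∃ e : R, (IsLeftId e ∧ ¬ IsRightId e) ∨ (IsRightId e ∧ ¬ IsLeftId e))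
    (x y : R) (hx : IsVertex x) (hy : IsVertex y) (hxy : x ≠ y)
    (hpath : ∃ n : ℕ, 1 ≤ n ∧ HasPathLen n x y) :
    ∃ n : ℕ, 1 ≤ n ∧ n ≤ 6 ∧ HasPathLen n x y := by
  obtain ⟨k, hk, f, h0, h1, hf⟩ := hpath
  obtain ⟨e, ⟨he, hne⟩ | ⟨he, hne⟩⟩ := hid
  · obtain ⟨v, hv⟩ := not_forall.1 hne
    have hedge : Edge x (f 1) := h0 ▸ hf 0 (by omega)
    exact IsLeftZD.exists_hasPathLen (sub_ne_zero.2 hv)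
      (fun u => by rw [sub_mul, mul_assoc, he, sub_self]) hx.1 hy.1 hxy
      ⟨f 1, hedge.2.1.1, hedge.2.2.2⟩
  · obtain ⟨v, hv⟩ := not_forall.1 hne
    have hedge : Edge (f (k - 1)) y := by
      have := hf (k - 1) (by omega)
      rwa [Nat.sub_add_cancel hk, h1] at this
    exact IsRightZD.exists_hasPathLen (sub_ne_zero.2 hv)
      (fun u => by rw [mul_sub, ← mul_assoc, he, sub_self]) hx.1 hy.1 hxy
      ⟨f (k - 1), hedge.1.1, hedge.2.2.2⟩
end

section
/- Let F be a field, n ≥ 2, and R the ring of n × n matrices over F. For any nonzero non-invertible matrices A, B ∈ R, there exists a nonzero matrix C ∈ R with AC = 0 and CB = 0. Consequently, any two distinct vertices of the directed zero-divisor graph Γ(R) are joined by a directed path of length at most 2. -/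
variable {R : Type*} [NonUnitalRing R]

theorem Matrix.exists_ne_zero_mul_eq_zero_and_mul_eq_zero {ι K : Type*} [Fintype ι]
    [DecidableEq ι] [Field K] {A B : Matrix ι ι K} (hA : ¬ IsUnit A) (hB : ¬ IsUnit B) :
    ∃ C : Matrix ι ι K, C ≠ 0 ∧ A * C = 0 ∧ C * B = 0 := by
  rw [Matrix.isUnit_iff_isUnit_det, isUnit_iff_ne_zero, not_not] at hA hB
  obtain ⟨v, hv, hAv⟩ := Matrix.exists_mulVec_eq_zero_iff.mpr hA
  obtain ⟨w, hw, hwB⟩ := Matrix.exists_vecMul_eq_zero_iff.mpr hB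
  refine ⟨Matrix.vecMulVec v w, Matrix.vecMulVec_ne_zero hv hw, ?_, ?_⟩
  · rw [Matrix.mul_vecMulVec, hAv, Matrix.zero_vecMulVec]
  · rw [Matrix.vecMulVec_mul, hwB, Matrix.vecMulVec_zero]

theorem IsVertex.not_isUnit {S : Type*} [Ring S] {x : S} (hx : IsVertex x) : ¬ IsUnit x := by
  intro hu
  obtain ⟨-, ⟨y, hy, hxy⟩ | ⟨y, hy, hyx⟩⟩ := hx
  · exact hy (hu.mul_right_eq_zero.mp hxy)
  · exact hy (hu.mul_left_eq_zero.mp hyx)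

theorem Edge.hasPathLen_one {x y : R} (h : Edge x y) : HasPathLen 1 x y := by
  refine ⟨fun i => if i = 0 then x else y, by simp, by simp, fun i hi => ?_⟩
  obtain rfl : i = 0 := by omega
  simpa using h

theorem Edge.hasPathLen_two {x y z : R} (hxy : Edge x y) (hyz : Edge y z) :
    HasPathLen 2 x z := by
  refine ⟨fun i => if i = 0 then x else if i = 1 then y else z, by simp, by simp, fun i hi => ?_⟩
  interval_cases i
  · simpa using hxy
  · simpa using hyz

theorem stmt6 (F : Type*) [Field F] (n : ℕ) (hn : 2 ≤ n) :
    (∀ A B : Matrix (Fin n) (Fin n) F, A ≠ 0 → ¬ IsUnit A → B ≠ 0 → ¬ IsUnit B →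
      ∃ C : Matrix (Fin n) (Fin n) F, C ≠ 0 ∧ A * C = 0 ∧ C * B = 0) ∧
    (∀ x y : Matrix (Fin n) (Fin n) F, IsVertex x → IsVertex y → x ≠ y →
      ∃ m : ℕ, 1 ≤ m ∧ m ≤ 2 ∧ HasPathLen m x y) := by
  refine ⟨fun A B _ hA _ hB => Matrix.exists_ne_zero_mul_eq_zero_and_mul_eq_zero hA hB,
    fun x y hx hy hne => ?_⟩
  by_cases hxy : x * y = 0
  · exact ⟨1, le_rfl, one_le_two, Edge.hasPathLen_one ⟨hx, hy, hne, hxy⟩⟩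
  obtain ⟨C, hC, hxC, hCy⟩ :=
    Matrix.exists_ne_zero_mul_eq_zero_and_mul_eq_zero hx.not_isUnit hy.not_isUnit
  have hCv : IsVertex C := ⟨hC, Or.inl ⟨y, hy.1, hCy⟩⟩
  have hx_ne : x ≠ C := fun h => hxy (h ▸ hCy)
  have hy_ne : C ≠ y := fun h => hxy (h ▸ hxC)
  exact ⟨2, one_le_two, le_rfl,
    Edge.hasPathLen_two ⟨hx, hCv, hx_ne, hxC⟩ ⟨hCv, hy, hy_ne, hCy⟩⟩
end

section
/- Let R be any ring. If there exists a source b in the directed zero-divisor graph Γ(R) with b² = 0, then R has exactly four elements: R = {0, a, b, c}, where a and c are left identity elements of R and ba = 0 = bc. -/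
variable {R : Type*} [NonUnitalRing R]

theorem stmt7 {R : Type*} [NonUnitalRing R]
    (b : R) (hb : IsSource b) (hb2 : b * b = 0) :
    ∃ a c : R, IsLeftId a ∧ IsLeftId c ∧ b * a = 0 ∧ b * c = 0 ∧
      a ≠ 0 ∧ b ≠ 0 ∧ c ≠ 0 ∧ a ≠ b ∧ a ≠ c ∧ b ≠ c ∧
      ∀ x : R, x = 0 ∨ x = a ∨ x = b ∨ x = c := by
  obtain ⟨⟨hb0, -⟩, ⟨a, ⟨ha0, -⟩, hab, hba⟩, hno⟩ := hb
  have hann : ∀ y : R, y * b = 0 → y = 0 ∨ y = b := by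
    intro y hy
    by_contra! h
    exact hno ⟨y, ⟨h.1, Or.inl ⟨b, hb0, hy⟩⟩, h.2, hy⟩
  have hbb : b + b = 0 := by
    rcases hann (-b) (by rw [neg_mul, hb2, neg_zero]) with h | h
    · exact absurd (neg_eq_zero.mp h) hb0
    · nth_rewrite 1 [← h]
      exact neg_add_cancel b
  have hmul : ∀ x : R, x * b = 0 ∨ x * b = b := fun x ↦
    hann (x * b) (by rw [mul_assoc, hb2, mul_zero])
  have hab' : a * b = b := (hmul a).resolve_left fun h ↦ (hann a h).elim ha0 hab
  have hall : ∀ x : R, x = 0 ∨ x = a ∨ x = b ∨ x = a + b := by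
    intro x
    rcases hmul x with h | h
    · rcases hann x h with h | h <;> simp [h]
    · rcases hann (x - a) (by rw [sub_mul, h, hab', sub_self]) with h | h
      · exact Or.inr (Or.inl (sub_eq_zero.mp h))
      · exact Or.inr (Or.inr (Or.inr (by rw [add_comm]; exact sub_eq_iff_eq_add.mp h)))
  have haab : a * a * b = b := by rw [mul_assoc, hab', hab']
  have haa : a * a = a := by
    rcases hall (a * a) with h | h | h | h
    · rw [h, zero_mul] at haab
      exact absurd haab.symm hb0
    · exact h
    · rw [h, hb2] at haab
      exact absurd haab.symm hb0
    · have hassoc := mul_assoc a a a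
      rw [h, add_mul, mul_add, h, hba, hab', add_zero, left_eq_add] at hassoc
      exact absurd hassoc hb0
  have hida : IsLeftId a := by
    intro x
    rcases hall x with rfl | rfl | rfl | rfl
    · exact mul_zero a
    · exact haa
    · exact hab'
    · rw [mul_add, haa, hab']
  have hbx : ∀ x : R, b * x = 0 := by
    intro x
    rcases hall x with rfl | rfl | rfl | rfl
    · exact mul_zero b
    · exact hba
    · exact hb2
    · rw [mul_add, hba, hb2, add_zero]
  refine ⟨a, a + b, hida, fun x ↦ by rw [add_mul, hida x, hbx x, add_zero], hba, hbx _,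
    ha0, hb0, fun h ↦ hab (add_right_cancel (h.trans hbb.symm)), hab, ?_, ?_, hall⟩
  · simpa using hb0
  · simpa using ha0
end

section
/- Let R be any ring. If there exists a sink b in the directed zero-divisor graph Γ(R) with b² = 0, then R has exactly four elements: R = {0, a, b, c}, where a and c are right identity elements of R and ab = 0 = cb. -/
variable {R : Type*} [NonUnitalRing R]

/-- The right annihilator of a square-zero sink `b` is contained in `{0, b}`. -/
theorem IsSink.eq_zero_or_eq_of_mul_eq_zero {R : Type*} [NonUnitalRing R] {b x : R}
    (hb : IsSink b) (hx : b * x = 0) : x = 0 ∨ x = b := by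
  by_contra! h
  exact hb.2.2 ⟨x, ⟨h.1, Or.inr ⟨b, hb.1.1, hx⟩⟩, h.2, hx⟩

theorem stmt8 {R : Type*} [NonUnitalRing R]
    (b : R) (hb : IsSink b) (hb2 : b * b = 0) :
    ∃ a c : R, IsRightId a ∧ IsRightId c ∧ a * b = 0 ∧ c * b = 0 ∧
      a ≠ 0 ∧ b ≠ 0 ∧ c ≠ 0 ∧ a ≠ b ∧ a ≠ c ∧ b ≠ c ∧
      ∀ x : R, x = 0 ∨ x = a ∨ x = b ∨ x = c := by 
  have ann : ∀ x : R, b * x = 0 → x = 0 ∨ x = b := fun _ => hb.eq_zero_or_eq_of_mul_eq_zero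
  have hb0 : b ≠ 0 := hb.1.1
  obtain ⟨a, ⟨ha0, -⟩, hab, hmul⟩ := hb.2.1
  have hbx : ∀ x : R, b * x = 0 ∨ b * x = b := fun x =>
    ann _ (by rw [← mul_assoc, hb2, zero_mul])
  have hba : b * a = b := (hbx a).resolve_left fun h => (ann a h).elim ha0 hab
  have hbb : b + b = 0 := by
    rcases ann (b + b) (by rw [mul_add, hb2, add_zero]) with h | h
    · exact h
    · exact absurd (add_eq_left.mp h) hb0
  have coset : ∀ x : R, b * x = b → x = a ∨ x = a + b := fun x hx => by
    rcases ann (x - a) (by rw [mul_sub, hx, hba, sub_self]) with h | h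
    · exact Or.inl (sub_eq_zero.mp h)
    · exact Or.inr (sub_eq_iff_eq_add'.mp h)
  have all : ∀ x : R, x = 0 ∨ x = a ∨ x = b ∨ x = a + b := fun x => by
    rcases hbx x with h | h
    · rcases ann x h with h | h <;> simp [h]
    · rcases coset x h with h | h <;> simp [h]
  have haa : a * a = a := by
    refine (coset (a * a) (by rw [← mul_assoc, hba, hba])).resolve_right fun h => ?_
    have h1 : a * a * a = a := by
      rw [h, add_mul, hba, h, add_assoc, hbb, add_zero]
    rw [mul_assoc, h, mul_add, hmul, add_zero, h] at h1
    exact hb0 (add_eq_left.mp h1)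
  have hxb : ∀ x : R, x * b = 0 := fun x => by
    rcases all x with rfl | rfl | rfl | rfl <;> simp [add_mul, hmul, hb2]
  have hxa : IsRightId a := fun x => by
    rcases all x with h | h | h | h <;> simp [h, add_mul, haa, hba]
  refine ⟨a, a + b, hxa, fun x => ?_, hxb a, hxb _, ha0, hb0, ?_, hab, ?_, ?_, all⟩
  · rw [mul_add, hxa, hxb, add_zero]
  · intro h
    exact hab (add_right_cancel (h.trans hbb.symm))
  · exact fun h => hb0 (add_eq_left.mp h.symm)
  · exact fun h => ha0 (add_eq_right.mp h.symm)
end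

section
/- Let R be a finite ring with at least five elements possessing a proper left identity element. Then: (1) Γ(R) contains at least two distinct sinks; (2) every sink r of Γ(R) satisfies r² ≠ 0; (3) Γ(R) contains no source. -/
variable {R : Type*} [NonUnitalRing R]

/-- An additive endomorphism whose kernel and range both lie in `{0, x}` forces at most four
elements. -/
theorem card_le_four_of_ker_of_range {A : Type*} [AddCommGroup A] [Fintype A] (x : A)
    (f : A →+ A) (hker : ∀ y, f y = 0 → y = 0 ∨ y = x) (hrange : ∀ y, f y = 0 ∨ f y = x) :
    Fintype.card A ≤ 4 := by
  have card_le_two (H : AddSubgroup A) (hH : ∀ y ∈ H, y = 0 ∨ y = x) : Nat.card H ≤ 2 :=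
    calc Nat.card H = (H : Set A).ncard := rfl
      _ ≤ ({0, x} : Set A).ncard := Set.ncard_le_ncard hH (Set.toFinite _)
      _ ≤ 2 := by simpa using Set.ncard_insert_le (0 : A) {x}
  have hk : Nat.card f.ker ≤ 2 := card_le_two _ hker
  have hr : Nat.card f.range ≤ 2 := card_le_two _ (by rintro _ ⟨y, rfl⟩; exact hrange y)
  have h := f.ker.card_mul_index
  rw [AddSubgroup.index_ker, Nat.card_eq_fintype_card (α := A)] at h
  rw [← h]
  exact Nat.mul_le_mul hk hr

/-- If a left identity is not a right identity, some nonzero element annihilates the ring from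
the left. -/
theorem IsLeftId.exists_ne_zero_mul_eq_zero {e : R} (he : IsLeftId e) (hr : ¬ IsRightId e) :
    ∃ n : R, n ≠ 0 ∧ ∀ x, n * x = 0 := by
  obtain ⟨a, ha⟩ := not_forall.mp hr
  exact ⟨a * e - a, sub_ne_zero.mpr ha, fun x => by rw [sub_mul, mul_assoc, he x, sub_self]⟩

/-- A left identity is a sink as soon as some nonzero element annihilates the ring from the
left. -/
theorem IsLeftId.isSink {e n : R} (he : IsLeftId e) (hn : n ≠ 0) (hann : ∀ x, n * x = 0) :
    IsSink e := by
  have he0 : e ≠ 0 := by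
    rintro rfl
    exact hn (by rw [← he n, zero_mul])
  have hne : n ≠ e := by
    rintro rfl
    exact hn (by rw [← he n, hann])
  refine ⟨⟨he0, Or.inr ⟨n, hn, hann e⟩⟩, ⟨n, ⟨hn, Or.inl ⟨e, he0, hann e⟩⟩, hne, hann e⟩, ?_⟩
  rintro ⟨y, hy, -, hey⟩
  exact hy.1 (by rw [← he y, hey])

theorem IsSink.mul_self_ne_zero [Fintype R] (hcard : 5 ≤ Fintype.card R) {r : R}
    (hr : IsSink r) : r * r ≠ 0 := by
  intro hrr
  have hker (y : R) (hy : r * y = 0) : y = 0 ∨ y = r := by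
    by_contra! h
    exact hr.2.2 ⟨y, ⟨h.1, Or.inr ⟨r, hr.1.1, hy⟩⟩, h.2, hy⟩
  have := card_le_four_of_ker_of_range r (AddMonoidHom.mulLeft r) hker
    fun y => hker (r * y) (by rw [← mul_assoc, hrr, zero_mul])
  lia

theorem not_isSource_of_mul_eq_zero [Fintype R] (hcard : 5 ≤ Fintype.card R) {n : R}
    (hn : n ≠ 0) (hann : ∀ x, n * x = 0) (x : R) : ¬ IsSource x := by
  intro hx
  have hker (y : R) (hy : y * x = 0) : y = 0 ∨ y = x := by
    by_contra! h
    exact hx.2.2 ⟨y, ⟨h.1, Or.inl ⟨x, hx.1.1, hy⟩⟩, h.2, hy⟩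
  obtain rfl : n = x := (hker n (hann x)).resolve_left hn
  have := card_le_four_of_ker_of_range n (AddMonoidHom.mulRight n) hker
    fun y => hker (y * n) (by rw [mul_assoc, hann, mul_zero])
  lia


theorem stmt9 {R : Type*} [NonUnitalRing R] [Fintype R]
    (hcard : 5 ≤ Fintype.card R)
    (he : ∃ e : R, IsLeftId e ∧ ¬ IsRightId e) :
    (∃ r s : R, r ≠ s ∧ IsSink r ∧ IsSink s) ∧
    (∀ r : R, IsSink r → r * r ≠ 0) ∧
    (¬ ∃ x : R, IsSource x) := by
  obtain ⟨e, he, hr⟩ := he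
  obtain ⟨n, hn, hann⟩ := he.exists_ne_zero_mul_eq_zero hr
  have hen : IsLeftId (e + n) := fun x => by rw [add_mul, he x, hann, add_zero]
  exact ⟨⟨e, e + n, by simpa using hn, he.isSink hn hann, hen.isSink hn hann⟩,
    fun r hs => hs.mul_self_ne_zero hcard,
    fun ⟨x, hx⟩ => not_isSource_of_mul_eq_zero hcard hn hann x hx⟩
end

section
/- Let R be a finite ring with at least five elements possessing a proper right identity element. Then: (1) Γ(R) contains at least two distinct sources; (2) every source r of Γ(R) satisfies r² ≠ 0; (3) Γ(R) contains no sink. -/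
variable {R : Type*} [NonUnitalRing R]

theorem AddMonoidHom.card_le_four_of_forall_ker_range {G : Type*} [AddCommGroup G] [Fintype G]
    (f : G →+ G) (a : G) (hker : ∀ y, f y = 0 → y = 0 ∨ y = a)
    (hrange : ∀ y, f y = 0 ∨ f y = a) : Fintype.card G ≤ 4 := by
  have hpair : ({0, a} : Set G).ncard ≤ 2 := by
    simpa using Set.ncard_insert_le (0 : G) {a}
  have hk : Nat.card f.ker ≤ 2 := by
    refine le_trans (Set.ncard_le_ncard (s := (f.ker : Set G)) (t := {0, a}) ?_) hpair
    intro y hy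
    exact hker y hy
  have hr : Nat.card f.range ≤ 2 := by
    refine le_trans (Set.ncard_le_ncard (s := (f.range : Set G)) (t := {0, a}) ?_) hpair
    rintro _ ⟨y, rfl⟩
    exact hrange y
  have h := AddSubgroup.card_mul_index f.ker
  rw [AddSubgroup.index_ker, Nat.card_eq_fintype_card (α := G)] at h
  rw [← h]
  exact Nat.mul_le_mul hk hr

theorem IsRightId.mul_eq_zero_of_mul_eq_zero {R : Type*} [NonUnitalRing R] {e n : R}
    (he : IsRightId e) (hn : e * n = 0) (x : R) : x * n = 0 := by
  rw [← he x, mul_assoc, hn, mul_zero]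

theorem IsRightId.exists_ne_zero_forall_mul_eq_zero {R : Type*} [NonUnitalRing R] {e : R}
    (he : IsRightId e) (hl : ¬ IsLeftId e) : ∃ n : R, n ≠ 0 ∧ ∀ x : R, x * n = 0 := by
  obtain ⟨z, hz⟩ := not_forall.mp hl
  refine ⟨e * z - z, sub_ne_zero.mpr hz, he.mul_eq_zero_of_mul_eq_zero ?_⟩
  rw [mul_sub, ← mul_assoc, he e, sub_self]

theorem IsRightId.isSource {R : Type*} [NonUnitalRing R] {e n : R} (he : IsRightId e)
    (hn : n ≠ 0) (hann : ∀ x : R, x * n = 0) : IsSource e := by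
  have hvertex {x : R} (hx : x ≠ 0) : IsVertex x := ⟨hx, Or.inl ⟨n, hn, hann x⟩⟩
  have he0 : e ≠ 0 := by
    rintro rfl
    exact hn (by rw [← he n, mul_zero])
  refine ⟨hvertex he0, ⟨n, hvertex hn, ?_, hann e⟩, ?_⟩
  · rintro rfl
    exact hn (by rw [← he n, hann])
  · rintro ⟨y, hy, -, hye⟩
    exact hy.1 (by rw [← he y, hye])

theorem stmt10 {R : Type*} [NonUnitalRing R] [Fintype R]
    (hcard : 5 ≤ Fintype.card R)
    (he : ∃ e : R, IsRightId e ∧ ¬ IsLeftId e) :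
    (∃ r s : R, r ≠ s ∧ IsSource r ∧ IsSource s) ∧
    (∀ r : R, IsSource r → r * r ≠ 0) ∧
    (¬ ∃ x : R, IsSink x) := by
  obtain ⟨e, he, hl⟩ := he
  obtain ⟨n, hn, hann⟩ := he.exists_ne_zero_forall_mul_eq_zero hl
  have hvertex {x : R} (hx : x ≠ 0) : IsVertex x := ⟨hx, Or.inl ⟨n, hn, hann x⟩⟩
  refine ⟨⟨e, e + n, by simpa using hn, he.isSource hn hann, ?_⟩, ?_, ?_⟩
  · have hen : IsRightId (e + n) := fun x => by rw [mul_add, he x, hann, add_zero]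
    exact hen.isSource hn hann
  · rintro r ⟨-, -, hr⟩ hrr
    have hker : ∀ y, y * r = 0 → y = 0 ∨ y = r := by
      intro y hy
      by_contra! h
      exact hr ⟨y, hvertex h.1, h.2, hy⟩
    have := (AddMonoidHom.mulRight r).card_le_four_of_forall_ker_range r hker
      (fun y => hker _ (by simp [mul_assoc, hrr]))
    omega
  · rintro ⟨x, -, -, hx⟩
    have hker : ∀ y, x * y = 0 → y = 0 ∨ y = x := by
      intro y hy
      by_contra! h
      exact hx ⟨y, hvertex h.1, h.2, hy⟩
    obtain rfl : n = x := (hker n (hann x)).resolve_left hn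
    have := (AddMonoidHom.mulLeft n).card_le_four_of_forall_ker_range n hker
      (fun y => hker _ (by simp [← mul_assoc, hann]))
    omega
end

section
/- Let R be a finite ring with at least five elements possessing a proper left identity element e, and suppose the left annihilator of e is {0, b} for some nonzero b ∈ R. Then by = 0 for every y ∈ R, and there exists a nonzero x ∈ R with x ≠ b and xb = 0 (so in Γ(R) the vertex b has an edge to every other vertex and has positive in-degree). -/
variable {R : Type*} [NonUnitalRing R]

theorem stmt11 {R : Type*} [NonUnitalRing R] [Fintype R]
    (hcard : 5 ≤ Fintype.card R)
    (e b : R) (he : IsLeftId e) (hne : ¬ IsRightId e) (hb : b ≠ 0)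
    (hann : {x : R | x * e = 0} = {0, b}) :
    (∀ y : R, b * y = 0) ∧ ∃ x : R, x ≠ 0 ∧ x ≠ b ∧ x * b = 0 := by
  classical
  have mem_ann (x : R) : x * e = 0 ↔ x = 0 ∨ x = b := by
    simpa using Set.ext_iff.mp hann x
  have hbe : b * e = 0 := (mem_ann b).mpr (Or.inr rfl)
  refine ⟨fun y => by rw [← he y, ← mul_assoc, hbe, zero_mul], ?_⟩
  by_contra! h
  have mul_b (x : R) (hx0 : x ≠ 0) (hxb : x ≠ b) : x * b = b :=
    ((mem_ann (x * b)).mp (by rw [mul_assoc, hbe, mul_zero])).resolve_left (h x hx0 hxb)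
  have exists_notMem (s : Finset R) (hs : s.card ≤ 4) : ∃ x, x ∉ s := by
    by_contra! hall
    have := Finset.card_le_card (fun x _ => hall x : Finset.univ ⊆ s)
    rw [Finset.card_univ] at this
    omega
  obtain ⟨x, hx⟩ := exists_notMem {0, b} (Finset.card_le_two.trans (by norm_num))
  obtain ⟨y, hy⟩ := exists_notMem {0, b, x, x + b} Finset.card_le_four
  simp only [Finset.mem_insert, Finset.mem_singleton, not_or] at hx hy
  refine h (y - x) (sub_ne_zero.mpr hy.2.2.1) (fun hyx => hy.2.2.2 ?_) ?_
  · rw [← hyx, add_sub_cancel]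
  · rw [sub_mul, mul_b x hx.1 hx.2, mul_b y hy.1 hy.2.1, sub_self]
end

section
/- Let R be a finite ring with at least five elements. Then the directed zero-divisor graph Γ(R) cannot contain both a sink and a source. -/
variable {R : Type*} [NonUnitalRing R]

/-- An additive endomorphism `f` with `f ∘ f = 0` and kernel inside `{0, z}` lives on a group
with at most four elements. -/
theorem card_le_four_of_ker_subset_pair {A : Type*} [AddCommGroup A] [Fintype A] (f : A →+ A)
    (z : A) (hker : ∀ a, f a = 0 → a = 0 ∨ a = z) (hsq : ∀ a, f (f a) = 0) :
    Fintype.card A ≤ 4 := by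
  have hpair : ({0, z} : Set A).ncard ≤ 2 := by
    simpa using Set.ncard_insert_le (0 : A) {z}
  have hk : Nat.card f.ker ≤ 2 :=
    (Set.ncard_le_ncard (s := (f.ker : Set A)) (fun a ha => hker a ha) (Set.toFinite _)).trans hpair
  have hr : Nat.card f.range ≤ 2 := by
    refine (Set.ncard_le_ncard (s := (f.range : Set A)) ?_ (Set.toFinite _)).trans hpair
    rintro _ ⟨a, rfl⟩
    exact hker _ (hsq a)
  have hmul : Nat.card f.range * Nat.card f.ker = Nat.card A := by
    rw [← AddSubgroup.index_ker, mul_comm, AddSubgroup.card_mul_index]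
  rw [← Nat.card_eq_fintype_card, ← hmul]
  exact Nat.mul_le_mul hr hk

/-- In a finite ring with at least five elements, left multiplication by a sink is bijective. -/
theorem IsSink.mul_left_bijective {R : Type*} [NonUnitalRing R] [Fintype R]
    (hcard : 5 ≤ Fintype.card R) {x : R} (hx : IsSink x) : Function.Bijective (x * ·) := by
  obtain ⟨⟨hx0, -⟩, -, hno⟩ := hx
  have hker : ∀ a, x * a = 0 → a = 0 ∨ a = x := by
    intro a ha
    by_contra! h
    exact hno ⟨a, ⟨h.1, Or.inr ⟨x, hx0, ha⟩⟩, h.2, ha⟩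
  refine Finite.injective_iff_bijective.mp
    ((injective_iff_map_eq_zero (AddMonoidHom.mulLeft x)).mpr fun a ha => ?_)
  refine (hker a ha).resolve_right ?_
  rintro rfl
  have hsq : a * a = 0 := ha
  have := card_le_four_of_ker_subset_pair (AddMonoidHom.mulLeft a) a hker
    fun b => by simp [← mul_assoc, hsq]
  omega

/-- In a finite ring with at least five elements, right multiplication by a source is
bijective. -/
theorem IsSource.mul_right_bijective {R : Type*} [NonUnitalRing R] [Fintype R]
    (hcard : 5 ≤ Fintype.card R) {s : R} (hs : IsSource s) : Function.Bijective (· * s) := by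
  obtain ⟨⟨hs0, -⟩, -, hno⟩ := hs
  have hker : ∀ a, a * s = 0 → a = 0 ∨ a = s := by
    intro a ha
    by_contra! h
    exact hno ⟨a, ⟨h.1, Or.inl ⟨s, hs0, ha⟩⟩, h.2, ha⟩
  refine Finite.injective_iff_bijective.mp
    ((injective_iff_map_eq_zero (AddMonoidHom.mulRight s)).mpr fun a ha => ?_)
  refine (hker a ha).resolve_right ?_
  rintro rfl
  have hsq : a * a = 0 := ha
  have := card_le_four_of_ker_subset_pair (AddMonoidHom.mulRight a) a hker
    fun b => by simp [mul_assoc, hsq]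
  omega

/-- If left multiplication by `x` is bijective, then there is a left identity in `x R`. -/
theorem exists_isLeftId_of_mul_left_bijective {R : Type*} [NonUnitalRing R] {x : R}
    (hx : Function.Bijective (x * ·)) : ∃ u : R, IsLeftId (x * u) := by
  obtain ⟨e, he⟩ := hx.2 x
  obtain ⟨u, rfl⟩ := hx.2 e
  refine ⟨u, fun r => hx.1 ?_⟩
  change x * (x * u) = x at he
  change x * (x * u * r) = x * r
  rw [← mul_assoc, he]

/-- If right multiplication by `s` is bijective, then there is a right identity. -/
theorem exists_isRightId_of_mul_right_bijective {R : Type*} [NonUnitalRing R] {s : R}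
    (hs : Function.Bijective (· * s)) : ∃ f : R, IsRightId f := by
  obtain ⟨f, hf⟩ := hs.2 s
  refine ⟨f, fun r => hs.1 ?_⟩
  change f * s = s at hf
  change r * f * s = r * s
  rw [mul_assoc, hf]

theorem stmt12 {R : Type*} [NonUnitalRing R] [Fintype R]
    (hcard : 5 ≤ Fintype.card R) :
    ¬ ((∃ x : R, IsSink x) ∧ ∃ y : R, IsSource y) := by
  rintro ⟨⟨x, hx⟩, s, hs⟩
  obtain ⟨u, hu⟩ := exists_isLeftId_of_mul_left_bijective (hx.mul_left_bijective hcard)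
  obtain ⟨f, hf⟩ := exists_isRightId_of_mul_right_bijective (hs.mul_right_bijective hcard)
  obtain ⟨-, ⟨y, ⟨hy0, -⟩, -, hyx⟩, -⟩ := hx
  have hxu : x * u = f := (hf (x * u)).symm.trans (hu f)
  apply hy0
  rw [← hf y, ← hxu, ← mul_assoc, hyx, zero_mul]
end

section
/- Let R be a finite ring and let r ∈ R satisfy r² ≠ 0. Then r is a sink vertex of Γ(R) if and only if r is strongly right invertible in R; dually, r is a source vertex of Γ(R) if and only if r is strongly left invertible in R. -/
variable {R : Type*} [NonUnitalRing R]

/-- `r` is strongly right invertible: `R` has a proper left identity and for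
every left identity `e` there is a unique `s` with `r * s = e`. -/
def StronglyRightInv (r : R) : Prop :=
  (∃ e : R, IsLeftId e ∧ ¬ IsRightId e) ∧
    ∀ e : R, IsLeftId e → ∃! s : R, r * s = e

/-- `r` is strongly left invertible: `R` has a proper right identity and for
every right identity `e` there is a unique `s` with `s * r = e`. -/
def StronglyLeftInv (r : R) : Prop :=
  (∃ e : R, IsRightId e ∧ ¬ IsLeftId e) ∧
    ∀ e : R, IsRightId e → ∃! s : R, s * r = e

open MulOpposite in
theorem isSink_op {R : Type*} [NonUnitalRing R] (r : R) : IsSink (op r) ↔ IsSource r := by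
  simp only [IsSink, IsSource, IsVertex, IsLeftZD, IsRightZD, op_surjective.exists, ← op_mul,
    op_eq_zero_iff, ne_eq, op_inj, or_comm]

open MulOpposite in
theorem stronglyRightInv_op {R : Type*} [NonUnitalRing R] (r : R) :
    StronglyRightInv (op r) ↔ StronglyLeftInv r := by
  simp only [StronglyRightInv, StronglyLeftInv, IsLeftId, IsRightId, ExistsUnique,
    op_surjective.exists, op_surjective.forall, ← op_mul, op_inj]

/-- In a finite ring, an element with nonzero square is a sink iff it is strongly right
invertible. -/
theorem isSink_iff_stronglyRightInv {R : Type*} [NonUnitalRing R] [Finite R]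
    (r : R) (hr : r * r ≠ 0) : IsSink r ↔ StronglyRightInv r := by
  have hr0 : r ≠ 0 := fun h => hr (by simp [h])
  constructor
  · rintro ⟨-, ⟨y, hy, -, hyr⟩, hout⟩
    have hinj : Function.Injective (r * ·) := by
      intro a b hab
      by_contra hne
      have h0 : r * (a - b) = 0 := by simpa [mul_sub, sub_eq_zero] using hab
      exact hout ⟨a - b, ⟨sub_ne_zero.2 hne, Or.inr ⟨r, hr0, h0⟩⟩,
        fun h => hr (by rwa [h] at h0), h0⟩
    have hsurj : Function.Surjective (r * ·) := Finite.surjective_of_injective hinj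
    obtain ⟨e, he : r * e = r⟩ := hsurj r
    refine ⟨⟨e, fun x => hinj (by simp only [← mul_assoc, he]), fun hright => hy.1 ?_⟩,
      fun f _ => Function.Bijective.existsUnique ⟨hinj, hsurj⟩ f⟩
    obtain ⟨s, hs : r * s = e⟩ := hsurj e
    rw [← hright y, ← hs, ← mul_assoc, hyr, zero_mul]
  · rintro ⟨⟨e, he, hright⟩, hinv⟩
    obtain ⟨s, hs, -⟩ := hinv e he
    have hsurj : Function.Surjective (r * ·) :=
      fun x => ⟨s * x, by simp only [← mul_assoc, hs, he x]⟩
    have hinj : Function.Injective (r * ·) := Finite.injective_iff_surjective.2 hsurj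
    obtain ⟨x, hx⟩ := not_forall.1 hright
    have hy0 : x - x * e ≠ 0 := sub_ne_zero.2 (Ne.symm hx)
    have hyr : (x - x * e) * r = 0 := by rw [sub_mul, mul_assoc, he, sub_self]
    refine ⟨⟨hr0, Or.inr ⟨_, hy0, hyr⟩⟩, ⟨_, ⟨hy0, Or.inl ⟨r, hr0, hyr⟩⟩,
      fun h => hr (by rwa [h] at hyr), hyr⟩, ?_⟩
    rintro ⟨y, hy, -, hry⟩
    exact hy.1 (hinj (by simpa using hry))

theorem stmt13 {R : Type*} [NonUnitalRing R] [Fintype R]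
    (r : R) (hr : r * r ≠ 0) :
    (IsSink r ↔ StronglyRightInv r) ∧ (IsSource r ↔ StronglyLeftInv r) := by
  refine ⟨isSink_iff_stronglyRightInv r hr, ?_⟩
  have : Finite Rᵐᵒᵖ := Finite.of_equiv R MulOpposite.opEquiv
  rw [← isSink_op, ← stronglyRightInv_op]
  exact isSink_iff_stronglyRightInv _ (by simpa [← MulOpposite.op_mul] using hr)
end

section
/- Let R be a finite ring. If the directed zero-divisor graph Γ(R) contains exactly one source b, then R has exactly four elements: R = {0, a, b, c}, where a and c are left identity elements of R, b² = 0, and ba = 0 = bc. -/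
variable {R : Type*} [NonUnitalRing R]

/-- A nonzero element with no nonzero left annihilator which kills some nonzero element on its right
is a source. -/
lemma isSource_of_left_regular {R : Type*} [NonUnitalRing R] {x y : R} (hx : x ≠ 0)
    (hreg : ∀ z : R, z * x = 0 → z = 0) (hy : y ≠ 0) (hxy : x * y = 0) : IsSource x := by
  refine ⟨⟨hx, Or.inl ⟨y, hy, hxy⟩⟩, ⟨y, ⟨hy, Or.inr ⟨x, hx, hxy⟩⟩, ?_, hxy⟩, ?_⟩
  · rintro rfl
    exact hx (hreg _ hxy)
  · rintro ⟨z, hz, -, hzx⟩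
    exact hz.1 (hreg z hzx)

/-- A unique source has square zero. -/
lemma sq_eq_zero_of_unique_source {R : Type*} [NonUnitalRing R] {b : R} (hb : IsSource b)
    (huniq : ∀ x : R, IsSource x → x = b) : b * b = 0 := by
  obtain ⟨⟨hb0, -⟩, ⟨y, ⟨hy0, -⟩, -, hby⟩, hin⟩ := hb
  by_contra hbb
  have hreg : ∀ z : R, z * b = 0 → z = 0 := by
    intro z hz
    by_contra hz0
    refine hin ⟨z, ⟨hz0, Or.inl ⟨b, hb0, hz⟩⟩, ?_, hz⟩
    rintro rfl
    exact hbb hz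
  have hidem : b * b = b := huniq _ <| isSource_of_left_regular hbb
    (fun z hz => hreg z (hreg _ (by rw [mul_assoc, hz]))) hy0 (by rw [mul_assoc, hby, mul_zero])
  have hright : ∀ x : R, x * b = x := fun x =>
    sub_eq_zero.1 (hreg _ (by rw [sub_mul, mul_assoc, hidem, sub_self]))
  have hann : ∀ x : R, x * y = 0 := fun x => by
    rw [← hright x, mul_assoc, hby, mul_zero]
  have hright' : ∀ x : R, x * (b + y) = x := fun x => by rw [mul_add, hright, hann, add_zero]
  have hne : b + y ≠ 0 := fun h => hb0 (by rw [← hright' b, h, mul_zero])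
  have := huniq _ <| isSource_of_left_regular hne
    (fun z hz => by rwa [hright'] at hz) hy0 (hann _)
  exact hy0 (by simpa using this)

theorem stmt14 {R : Type*} [NonUnitalRing R] [Fintype R]
    (b : R) (hb : IsSource b) (huniq : ∀ x : R, IsSource x → x = b) :
    ∃ a c : R, IsLeftId a ∧ IsLeftId c ∧ b * b = 0 ∧ b * a = 0 ∧ b * c = 0 ∧
      a ≠ 0 ∧ b ≠ 0 ∧ c ≠ 0 ∧ a ≠ b ∧ a ≠ c ∧ b ≠ c ∧
      ∀ x : R, x = 0 ∨ x = a ∨ x = b ∨ x = c := by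
  have hbb := sq_eq_zero_of_unique_source hb huniq
  obtain ⟨⟨hb0, -⟩, ⟨y, ⟨hy0, -⟩, hyb, hby⟩, hin⟩ := hb
  have hann : ∀ z : R, z * b = 0 → z = 0 ∨ z = b := by
    intro z hz
    by_contra! h
    exact hin ⟨z, ⟨h.1, Or.inl ⟨b, hb0, hz⟩⟩, h.2, hz⟩
  have hmul : ∀ r : R, r * b = 0 ∨ r * b = b := fun r =>
    hann _ (by rw [mul_assoc, hbb, mul_zero])
  have htwo : b + b = 0 := by
    rcases hann (b + b) (by rw [add_mul, hbb, add_zero]) with h | h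
    · exact h
    · exact absurd (by simpa using h) hb0
  have hyb' : y * b = b := (hmul y).resolve_left fun h => by
    rcases hann y h with h | h
    exacts [hy0 h, hyb h]
  have hcases : ∀ r : R, r * b = b → r = y ∨ r = b + y := by
    intro r hr
    rcases hann (r - y) (by rw [sub_mul, hr, hyb', sub_self]) with h | h
    · exact Or.inl (sub_eq_zero.1 h)
    · exact Or.inr (sub_eq_iff_eq_add.1 h)
  have hall : ∀ r : R, r = 0 ∨ r = y ∨ r = b ∨ r = b + y := by
    intro r
    rcases hmul r with h | h
    · rcases hann r h with h | h <;> simp [h]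
    · rcases hcases r h with h | h <;> simp [h]
  have hyy : y * y = y := by
    refine (hcases (y * y) (by rw [mul_assoc, hyb', hyb'])).resolve_right fun h => hb0 ?_
    have h1 : y * y * y = b + y := by rw [h, add_mul, hby, zero_add, h]
    have h2 : y * y * y = y := by
      rw [mul_assoc, h, mul_add, hyb', h, ← add_assoc, htwo, zero_add]
    simpa using h1.symm.trans h2
  refine ⟨y, b + y, ?_, ?_, hbb, hby, by rw [mul_add, hbb, hby, add_zero], hy0, hb0, ?_, hyb,
    by simpa using hb0, by simpa using hy0, hall⟩
  · intro x
    rcases hall x with rfl | rfl | rfl | rfl <;> simp [mul_add, *]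
  · intro x
    rcases hall x with rfl | rfl | rfl | rfl <;> simp [mul_add, add_mul, *]
  · intro h
    refine hyb ?_
    rw [← add_left_cancel (h.trans htwo.symm)]
end

section
/- Let R be any ring with at least five elements, and let Sink(R) and Sour(R) denote the sets of sinks and sources of Γ(R). If Sink(R) is nonempty, then it is closed under multiplication and left cancellative: for all a, b ∈ Sink(R), ab ∈ Sink(R), and for all a, b, c ∈ Sink(R), ab = ac implies b = c. Dually, if Sour(R) is nonempty, then it is closed under multiplication and right cancellative. -/
variable {R : Type*} [NonUnitalRing R]

theorem isLeftRegular_of_rightAnnihilator_subset {R : Type*} [NonUnitalRing R]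
    (hcard : ∃ s : Finset R, 5 ≤ s.card) {a : R}
    (ha : ∀ x : R, a * x = 0 → x = 0 ∨ x = a) : ∀ x : R, a * x = 0 → x = 0 := by
  classical
  intro x hx
  by_contra hx0
  obtain rfl : x = a := (ha x hx).resolve_left hx0
  obtain ⟨s, hs⟩ := hcard
  have hmul (y : R) : x * y = 0 ∨ x * y = x := ha _ (by rw [← mul_assoc, hx, zero_mul])
  obtain ⟨e, he⟩ : ∃ e : R, ∀ y, x * y = x → y = e ∨ y = x + e := by
    by_cases h : ∃ e, x * e = x
    · obtain ⟨e, he⟩ := h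
      refine ⟨e, fun y hy => ?_⟩
      rcases ha (y - e) (by rw [mul_sub, hy, he, sub_self]) with h | h
      · exact .inl (sub_eq_zero.mp h)
      · exact .inr (sub_eq_iff_eq_add.mp h)
    · exact ⟨0, fun y hy => (h ⟨y, hy⟩).elim⟩
  have hsub : s ⊆ {0, x, e, x + e} := by
    intro y _
    simp only [Finset.mem_insert, Finset.mem_singleton]
    rcases hmul y with h | h
    · rcases ha y h with h | h <;> simp [h]
    · rcases he y h with h | h <;> simp [h]
  have := (Finset.card_le_card hsub).trans Finset.card_le_four
  omega

theorem isSink_iff {R : Type*} [NonUnitalRing R] (hcard : ∃ s : Finset R, 5 ≤ s.card) (a : R) :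
    IsSink a ↔ IsRightZD a ∧ ∀ x : R, a * x = 0 → x = 0 := by
  constructor
  · rintro ⟨⟨ha0, _⟩, ⟨y, hy, _, hya⟩, hout⟩
    refine ⟨⟨y, hy.1, hya⟩, isLeftRegular_of_rightAnnihilator_subset hcard fun x hx => ?_⟩
    by_contra! h
    exact hout ⟨x, ⟨h.1, .inr ⟨a, ha0, hx⟩⟩, h.2, hx⟩
  · rintro ⟨⟨y, hy, hya⟩, hreg⟩
    have ha0 : a ≠ 0 := by
      rintro rfl
      exact hy (hreg y (zero_mul y))
    refine ⟨⟨ha0, .inr ⟨y, hy, hya⟩⟩, ⟨y, ⟨hy, .inl ⟨a, ha0, hya⟩⟩, ?_, hya⟩, ?_⟩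
    · rintro rfl
      exact hy (hreg y hya)
    · rintro ⟨z, hz, _, haz⟩
      exact hz.1 (hreg z haz)

theorem IsSink.mul {R : Type*} [NonUnitalRing R] (hcard : ∃ s : Finset R, 5 ≤ s.card) {a b : R}
    (ha : IsSink a) (hb : IsSink b) : IsSink (a * b) := by
  rw [isSink_iff hcard] at *
  obtain ⟨⟨y, hy, hya⟩, ha⟩ := ha
  refine ⟨⟨y, hy, by rw [← mul_assoc, hya, zero_mul]⟩, fun x hx => hb.2 x (ha _ ?_)⟩
  rw [← mul_assoc, hx]

theorem IsSink.mul_left_cancel {R : Type*} [NonUnitalRing R]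
    (hcard : ∃ s : Finset R, 5 ≤ s.card) {a b c : R} (ha : IsSink a) (h : a * b = a * c) :
    b = c :=
  sub_eq_zero.mp (((isSink_iff hcard a).mp ha).2 _ (by rw [mul_sub, h, sub_self]))

open MulOpposite in
theorem isSink_op_iff {R : Type*} [NonUnitalRing R] (a : R) : IsSink (op a) ↔ IsSource a := by
  simp only [IsSink, IsSource, IsVertex, IsLeftZD, IsRightZD, MulOpposite.exists, ← op_mul,
    op_eq_zero_iff, ne_eq, op_inj, or_comm]

theorem exists_finset_mulOpposite {R : Type*} {n : ℕ} (h : ∃ s : Finset R, n ≤ s.card) :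
    ∃ s : Finset Rᵐᵒᵖ, n ≤ s.card := by
  obtain ⟨s, hs⟩ := h
  exact ⟨s.map MulOpposite.opEquiv.toEmbedding, by rwa [Finset.card_map]⟩

theorem stmt15 {R : Type*} [NonUnitalRing R]
    (hcard : ∃ s : Finset R, 5 ≤ s.card) :
    ((∃ x : R, IsSink x) →
      (∀ a b : R, IsSink a → IsSink b → IsSink (a * b)) ∧
      (∀ a b c : R, IsSink a → IsSink b → IsSink c → a * b = a * c → b = c)) ∧
    ((∃ x : R, IsSource x) →
      (∀ a b : R, IsSource a → IsSource b → IsSource (a * b)) ∧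
      (∀ a b c : R, IsSource a → IsSource b → IsSource c → b * a = c * a → b = c)) := by
  refine ⟨fun _ => ⟨fun a b ha hb => ha.mul hcard hb, fun a b c ha _ _ h =>
    ha.mul_left_cancel hcard h⟩, fun _ => ⟨fun a b ha hb => ?_, fun a b c ha _ _ h => ?_⟩⟩
  · rw [← isSink_op_iff] at *
    exact hb.mul (exists_finset_mulOpposite hcard) ha
  · rw [← isSink_op_iff] at ha
    exact MulOpposite.op_injective (ha.mul_left_cancel (exists_finset_mulOpposite hcard)
      (congrArg MulOpposite.op h))
end

section
/- Let R be a ring with at least five elements in which every one-sided identity element is a two-sided identity. If R satisfies the descending chain condition on principal right ideals, then Γ(R) contains no sink; dually, if R satisfies the descending chain condition on principal left ideals, then Γ(R) contains no source. In particular, if R is both left and right artinian and every one-sided identity of R is a two-sided identity, then Γ(R) contains neither sink nor source. -/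
variable {R : Type*} [NonUnitalRing R]

/-- `S` is a right ideal of the (possibly non-unital) ring `R`. -/
def IsRightIdealSet (S : Set R) : Prop :=
  (0 : R) ∈ S ∧ (∀ x ∈ S, ∀ y ∈ S, x - y ∈ S) ∧ ∀ x ∈ S, ∀ r : R, x * r ∈ S

/-- `S` is a left ideal of the (possibly non-unital) ring `R`. -/
def IsLeftIdealSet (S : Set R) : Prop :=
  (0 : R) ∈ S ∧ (∀ x ∈ S, ∀ y ∈ S, x - y ∈ S) ∧ ∀ x ∈ S, ∀ r : R, r * x ∈ S

/-- The principal right ideal generated by `a`. -/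
def rSpan (a : R) : Set R := ⋂₀ {S : Set R | IsRightIdealSet S ∧ a ∈ S}

/-- The principal left ideal generated by `a`. -/
def lSpan (a : R) : Set R := ⋂₀ {S : Set R | IsLeftIdealSet S ∧ a ∈ S}

theorem isRightIdealSet_rSpan (a : R) :
    IsRightIdealSet (rSpan a) :=
  ⟨fun _ hS => hS.1.1,
    fun x hx y hy S hS => hS.1.2.1 x (hx S hS) y (hy S hS),
    fun x hx r S hS => hS.1.2.2 x (hx S hS) r⟩

theorem isLeftIdealSet_lSpan (a : R) :
    IsLeftIdealSet (lSpan a) :=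
  ⟨fun _ hS => hS.1.1,
    fun x hx y hy S hS => hS.1.2.1 x (hx S hS) y (hy S hS),
    fun x hx r S hS => hS.1.2.2 x (hx S hS) r⟩

theorem mem_rSpan_self (a : R) : a ∈ rSpan a :=
  fun _ hS => hS.2

theorem rSpan_subset_of_mem {a b : R} (h : b ∈ rSpan a) :
    rSpan b ⊆ rSpan a :=
  fun _ hz => hz _ ⟨isRightIdealSet_rSpan a, h⟩

theorem exists_eq_of_mem_rSpan {a b : R} (h : b ∈ rSpan a) :
    ∃ (k : ℤ) (r : R), b = k • a + a * r := by
  refine h {b | ∃ (k : ℤ) (r : R), b = k • a + a * r} ⟨⟨⟨0, 0, by simp⟩, ?_, ?_⟩, 1, 0, by simp⟩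
  · rintro _ ⟨k, r, rfl⟩ _ ⟨l, s, rfl⟩
    exact ⟨k - l, r - s, by rw [sub_smul, mul_sub]; abel⟩
  · rintro _ ⟨k, r, rfl⟩ t
    refine ⟨0, k • t + r * t, ?_⟩
    rw [add_mul, mul_add, mul_assoc, smul_mul_assoc, mul_smul_comm, zero_smul, zero_add]

/-- Under the descending chain condition on principal right ideals, an element with zero right
annihilator lies in the right ideal generated by its square. -/
theorem exists_eq_mul_self_of_dcc
    (hdcc : ¬ ∃ f : ℕ → R, ∀ n : ℕ, rSpan (f (n + 1)) ⊂ rSpan (f n))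
    {x : R} (hx : ∀ z : R, x * z = 0 → z = 0) :
    ∃ (k : ℤ) (r : R), x = k • (x * x) + x * x * r := by
  let f : ℕ → R := fun n => (x * ·)^[n] x
  have f_succ (n : ℕ) : f (n + 1) = x * f n := Function.iterate_succ_apply' _ _ _
  have f_succ' (n : ℕ) : f (n + 1) = f n * x := by
    induction n with
    | zero => rfl
    | succ n ih => rw [f_succ, ih, ← mul_assoc, ← f_succ, ih]
  have descend (n : ℕ) (k : ℤ) (r : R) (h : f n = k • f (n + 1) + f (n + 1) * r) :
      x = k • (x * x) + x * x * r := by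
    induction n with
    | zero => exact h
    | succ n ih =>
      refine ih (sub_eq_zero.1 (hx _ ?_))
      rw [mul_sub, mul_add, mul_smul_comm, ← mul_assoc, ← f_succ, ← f_succ]
      exact sub_eq_zero.2 h
  push Not at hdcc
  obtain ⟨n, hn⟩ := hdcc f
  have hsub : rSpan (f (n + 1)) ⊆ rSpan (f n) := by
    apply rSpan_subset_of_mem
    rw [f_succ']
    exact (isRightIdealSet_rSpan _).2.2 _ (mem_rSpan_self _) x
  have hmem : f n ∈ rSpan (f (n + 1)) := by
    by_contra h
    exact hn ⟨hsub, fun h' => h (h' (mem_rSpan_self _))⟩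
  obtain ⟨k, r, h⟩ := exists_eq_of_mem_rSpan hmem
  exact ⟨k, r, descend n k r h⟩

/-- A ring containing a nilsquare element `x` with right annihilator inside `{0, x}` has at most
four elements. -/
theorem card_le_four_of_mul_self_eq_zero_s19 {x : R}
    (hx : x * x = 0) (hann : ∀ z : R, x * z = 0 → z = 0 ∨ z = x) (s : Finset R) :
    s.card ≤ 4 := by
  classical
  obtain ⟨t, ht⟩ : ∃ t : R, ∀ z : R, x * z = x → x * t = x := by
    by_cases h : ∃ t : R, x * t = x
    · exact ⟨h.choose, fun _ _ => h.choose_spec⟩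
    · exact ⟨0, fun z hz => absurd ⟨z, hz⟩ h⟩
  have hsub : s ⊆ {0, x, t, x + t} := by
    intro z _
    simp only [Finset.mem_insert, Finset.mem_singleton]
    rcases hann (x * z) (by rw [← mul_assoc, hx, zero_mul]) with h | h
    · rcases hann z h with h | h <;> simp [h]
    · rcases hann (z - t) (by rw [mul_sub, h, ht z h, sub_self]) with h | h
      · simp [sub_eq_zero.1 h]
      · simp [sub_eq_iff_eq_add.1 h]
  exact (Finset.card_le_card hsub).trans Finset.card_le_four

theorem not_exists_isSink_of_dcc
    (hcard : ∃ s : Finset R, 5 ≤ s.card)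
    (hid : ∀ e : R, IsLeftId e → IsRightId e)
    (hdcc : ¬ ∃ f : ℕ → R, ∀ n : ℕ, rSpan (f (n + 1)) ⊂ rSpan (f n)) :
    ¬ ∃ x : R, IsSink x := by
  rintro ⟨x, ⟨hx0, -⟩, ⟨y, ⟨hy0, -⟩, -, hyx⟩, hout⟩
  have hann (z : R) (hz : x * z = 0) : z = 0 ∨ z = x := by
    by_contra! h
    exact hout ⟨z, ⟨h.1, Or.inr ⟨x, hx0, hz⟩⟩, h.2, hz⟩
  by_cases hxx : x * x = 0
  · obtain ⟨s, hs⟩ := hcard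
    have := card_le_four_of_mul_self_eq_zero_s19 hxx hann s
    omega
  have hreg (z : R) (hz : x * z = 0) : z = 0 :=
    (hann z hz).resolve_right fun h => hxx (by rwa [h] at hz)
  obtain ⟨k, r, hkr⟩ := exists_eq_mul_self_of_dcc hdcc hreg
  have hxe : x * (k • x + x * r) = x := by
    rw [mul_add, mul_smul_comm, ← mul_assoc, ← hkr]
  have hleft : IsLeftId (k • x + x * r) := fun z =>
    sub_eq_zero.1 (hreg _ (by rw [mul_sub, ← mul_assoc, hxe, sub_self]))
  apply hy0
  rw [← hid _ hleft y, mul_add, mul_smul_comm, ← mul_assoc, hyx, smul_zero, zero_mul, add_zero]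

open MulOpposite in
theorem isLeftIdealSet_preimage_op {S : Set Rᵐᵒᵖ}
    (hS : IsRightIdealSet S) : IsLeftIdealSet (op ⁻¹' S) :=
  ⟨hS.1, fun x hx y hy => hS.2.1 (op x) hx (op y) hy, fun x hx r => hS.2.2 (op x) hx (op r)⟩

open MulOpposite in
theorem isRightIdealSet_preimage_unop {S : Set R}
    (hS : IsLeftIdealSet S) : IsRightIdealSet (unop ⁻¹' S) :=
  ⟨hS.1, fun x hx y hy => hS.2.1 (unop x) hx (unop y) hy,
    fun x hx r => hS.2.2 (unop x) hx (unop r)⟩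

open MulOpposite in
theorem rSpan_eq_preimage_lSpan (a : Rᵐᵒᵖ) :
    rSpan a = unop ⁻¹' lSpan (unop a) := by
  ext b
  constructor
  · exact fun hb S hS => hb (unop ⁻¹' S) ⟨isRightIdealSet_preimage_unop hS.1, hS.2⟩
  · exact fun hb S hS => hb (op ⁻¹' S) ⟨isLeftIdealSet_preimage_op hS.1, hS.2⟩

open MulOpposite in
theorem IsVertex.op {x : R} (hx : IsVertex x) :
    IsVertex (MulOpposite.op x) := by
  refine ⟨(op_ne_zero_iff x).2 hx.1, hx.2.symm.imp ?_ ?_⟩ <;>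
  · rintro ⟨y, hy, h⟩
    exact ⟨MulOpposite.op y, (op_ne_zero_iff y).2 hy, congrArg MulOpposite.op h⟩

open MulOpposite in
theorem IsVertex.unop {x : Rᵐᵒᵖ} (hx : IsVertex x) :
    IsVertex (MulOpposite.unop x) := by
  refine ⟨(unop_ne_zero_iff x).2 hx.1, hx.2.symm.imp ?_ ?_⟩ <;>
  · rintro ⟨y, hy, h⟩
    exact ⟨MulOpposite.unop y, (unop_ne_zero_iff y).2 hy, congrArg MulOpposite.unop h⟩

open MulOpposite in
theorem IsSource.isSink_op {x : R} (hx : IsSource x) :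
    IsSink (op x) := by
  obtain ⟨hv, ⟨y, hy, hyx, hxy⟩, hin⟩ := hx
  refine ⟨hv.op, ⟨op y, hy.op, op_injective.ne hyx, congrArg op hxy⟩, ?_⟩
  rintro ⟨z, hz, hzx, hxz⟩
  exact hin ⟨unop z, hz.unop, fun h => hzx (unop_injective h), congrArg unop hxz⟩

open MulOpposite in
theorem not_exists_isSource_of_dcc
    (hcard : ∃ s : Finset R, 5 ≤ s.card)
    (hid : ∀ e : R, IsRightId e → IsLeftId e)
    (hdcc : ¬ ∃ f : ℕ → R, ∀ n : ℕ, lSpan (f (n + 1)) ⊂ lSpan (f n)) :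
    ¬ ∃ x : R, IsSource x := by
  rintro ⟨x, hx⟩
  obtain ⟨s, hs⟩ := hcard
  refine not_exists_isSink_of_dcc (R := Rᵐᵒᵖ)
    ⟨s.map opEquiv.toEmbedding, by rwa [Finset.card_map]⟩ ?_ ?_ ⟨op x, hx.isSink_op⟩
  · intro e he z
    exact congrArg op (hid (unop e) (fun w => congrArg unop (he (op w))) (unop z))
  · rintro ⟨f, hf⟩
    refine hdcc ⟨fun n => unop (f n), fun n => ?_⟩
    have h := hf n
    rw [rSpan_eq_preimage_lSpan, rSpan_eq_preimage_lSpan] at h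
    exact ⟨fun z hz => h.1 (show op z ∈ _ from hz),
      fun h' => h.2 fun z hz => h' hz⟩

theorem stmt19 {R : Type*} [NonUnitalRing R]
    (hcard : ∃ s : Finset R, 5 ≤ s.card)
    (hid : ∀ e : R, (IsLeftId e → IsRightId e) ∧ (IsRightId e → IsLeftId e)) :
    ((¬ ∃ f : ℕ → R, ∀ n : ℕ, rSpan (f (n + 1)) ⊂ rSpan (f n)) →
      ¬ ∃ x : R, IsSink x) ∧
    ((¬ ∃ f : ℕ → R, ∀ n : ℕ, lSpan (f (n + 1)) ⊂ lSpan (f n)) →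
      ¬ ∃ x : R, IsSource x) ∧
    (((¬ ∃ g : ℕ → Set R, (∀ n : ℕ, IsLeftIdealSet (g n)) ∧
          ∀ n : ℕ, g (n + 1) ⊂ g n) ∧
      (¬ ∃ g : ℕ → Set R, (∀ n : ℕ, IsRightIdealSet (g n)) ∧
          ∀ n : ℕ, g (n + 1) ⊂ g n)) →
      (¬ ∃ x : R, IsSink x) ∧ ¬ ∃ x : R, IsSource x) := by
  have sink := not_exists_isSink_of_dcc hcard fun e => (hid e).1
  have source := not_exists_isSource_of_dcc hcard fun e => (hid e).2
  refine ⟨sink, source, fun ⟨hl, hr⟩ => ⟨sink ?_, source ?_⟩⟩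
  · rintro ⟨f, hf⟩
    exact hr ⟨fun n => rSpan (f n), fun n => isRightIdealSet_rSpan _, hf⟩
  · rintro ⟨f, hf⟩
    exact hl ⟨fun n => lSpan (f n), fun n => isLeftIdealSet_lSpan _, hf⟩
end
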